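/- arXiv:2206.15322 — 2 statements merged into one kernel-verified Lean document; each statement's English description precedes it below -/
import Mathlib

section
/- Let r₀ ≥ 1 and J ≤ r₀ be natural numbers and let ι : Fin J → Fin r₀ be injective. Let α₀ : Fin r₀ → ℝ with α₀ k > 0 for all k, and n₀ : Fin r₀ → ℝ with n₀ k ≥ 0 for all k. For each j ∈ Fin J let r j ≥ 1, let α_j : Fin (r j) → ℝ with α_j k > 0 for all k, and n_j : Fin (r j) → ℝ with n_j k ≥ 0 for all k, and assume mass conservation: ∑_{k} α_j k = α₀ (ι j) and ∑_{k} n_j k = n₀ (ι j) for every j. Set A = ∑_{k} α₀ k and N = ∑_{k} n₀ k. Then (Γ(A)/Γ(A + N) · ∏_{k=1}^{r₀} Γ(α₀ k + n₀ k)/Γ(α₀ k)) · ∏_{j=1}^{J} (Γ(α₀ (ι j))/Γ(α₀ (ι j) + n₀ (ι j)) · ∏_{k=1}^{r j} Γ(α_j k + n_j k)/Γ(α_j k)) = Γ(A)/Γ(A + N) · (∏_{k ∉ range ι} Γ(α₀ k + n₀ k)/Γ(α₀ k)) · ∏_{j=1}^{J} ∏_{k=1}^{r j} Γ(α_j k +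 n_j k)/Γ(α_j k). (This is the algebraic content of Lemma 3: for a saturated subtree with at most two levels, in the stage-wise BDepu product the factor of each singleton stage at distance 1 from the root cancels against the corresponding edge factor of the root, so that only the edges entering subleaves contribute; hence the BDepu score of the saturated subtree equals the BDepu score of the floret obtained by the resize operator, whose edges carry exactly the hyperparameters and counts of the subleaf-entering edges.) -/
open Real Finset

/-- Lemma 3 (algebraic content): in the stage-wise BDepu product of a saturated
two-level subtree, the factor of each singleton stage at distance 1 from the root
cancels against the corresponding edge factor of the root, so only the edges
entering subleaves contribute; hence the BDepu score of the saturated subtree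
equals that of the floret obtained by the resize operator. -/
theorem bdepu_resize_saturated (r₀ J : ℕ) (hr₀ : 1 ≤ r₀) (hJ : J ≤ r₀)
    (ι : Fin J → Fin r₀) (hι : Function.Injective ι)
    (α₀ n₀ : Fin r₀ → ℝ)
    (hα₀ : ∀ k, 0 < α₀ k) (hn₀ : ∀ k, 0 ≤ n₀ k)
    (r : Fin J → ℕ) (hr : ∀ j, 1 ≤ r j)
    (α : (j : Fin J) → Fin (r j) → ℝ) (hα : ∀ j k, 0 < α j k)
    (n : (j : Fin J) → Fin (r j) → ℝ) (hn : ∀ j k, 0 ≤ n j k)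
    (hmassα : ∀ j, ∑ k, α j k = α₀ (ι j))
    (hmassn : ∀ j, ∑ k, n j k = n₀ (ι j)) :
    (Real.Gamma (∑ k, α₀ k) / Real.Gamma ((∑ k, α₀ k) + (∑ k, n₀ k)) *
        ∏ k, Real.Gamma (α₀ k + n₀ k) / Real.Gamma (α₀ k)) *
      ∏ j, (Real.Gamma (α₀ (ι j)) / Real.Gamma (α₀ (ι j) + n₀ (ι j)) *
        ∏ k, Real.Gamma (α j k + n j k) / Real.Gamma (α j k)) =
    Real.Gamma (∑ k, α₀ k) / Real.Gamma ((∑ k, α₀ k) + (∑ k, n₀ k)) *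
      (∏ k ∈ (Finset.image ι Finset.univ)ᶜ,
        Real.Gamma (α₀ k + n₀ k) / Real.Gamma (α₀ k)) *
      ∏ j, ∏ k, Real.Gamma (α j k + n j k) / Real.Gamma (α j k) := by
  have hcancel : (∏ j, Real.Gamma (α₀ (ι j) + n₀ (ι j)) / Real.Gamma (α₀ (ι j))) *
      ∏ j, Real.Gamma (α₀ (ι j)) / Real.Gamma (α₀ (ι j) + n₀ (ι j)) = 1 := by
    rw [← Finset.prod_mul_distrib]
    refine Finset.prod_eq_one fun j _ => ?_
    have hα₀j := (Real.Gamma_pos_of_pos (hα₀ (ι j))).ne'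
    have hsum := (Real.Gamma_pos_of_pos (add_pos_of_pos_of_nonneg (hα₀ (ι j)) (hn₀ (ι j)))).ne'
    field_simp
  rw [Finset.prod_mul_distrib, ← Finset.prod_compl_mul_prod (Finset.image ι Finset.univ),
    Finset.prod_image hι.injOn]
  linear_combination (Real.Gamma (∑ k, α₀ k) / Real.Gamma ((∑ k, α₀ k) + (∑ k, n₀ k)) *
      (∏ k ∈ (Finset.image ι Finset.univ)ᶜ, Real.Gamma (α₀ k + n₀ k) / Real.Gamma (α₀ k)) *
      ∏ j, ∏ k, Real.Gamma (α j k + n j k) / Real.Gamma (α j k)) * hcancel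
end

section
/- Let Q ≥ 1, r₀ ≥ 1 and J ≤ r₀ be natural numbers and let ι : Fin J → Fin r₀ be injective. Let a : Fin r₀ → ℝ with a k > 0 for all k (the shared per-copy root-edge hyperparameters) and let n : Fin Q → Fin r₀ → ℝ with n q k ≥ 0 for all q, k (the per-copy root-edge counts). For each j ∈ Fin J let r j ≥ 1, let a_j : Fin (r j) → ℝ with a_j k > 0 (the shared per-copy hyperparameters of the j-th internal stage's outgoing edges) and let n' : Fin Q → (j : Fin J) → Fin (r j) → ℝ with n' q j k ≥ 0, and assume per-copy mass conservation: ∑_{k} a_j k = a (ι j) for every j, and ∑_{k} n' q j k = n q (ι j) for every q and j. Set A = ∑_{k} a k and N = ∑_{q} ∑_{k} n q k. Then (Γ(Q·A)/Γ(Q·A + N) · ∏_{k=1}^{r₀} Γ(Q·(a k) + ∑_q n q k)/Γ(Q·(a k))) · ∏_{j=1}^{J} (Γ(Q·(a (ι j)))/Γ(Q·(a (ι j)) + ∑_q n q (ι j)) · ∏_{k=1}^{r j} Γ(Q·(a_j k) + ∑_q n' q j k)/Γ(Q·(a_j k))) = Γ(Q·A)/Γ(Q·A + N) · (∏_{k ∉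 range ι} Γ(Q·(a k) + ∑_q n q k)/Γ(Q·(a k))) · ∏_{j=1}^{J} ∏_{k=1}^{r j} Γ(Q·(a_j k) + ∑_q n' q j k)/Γ(Q·(a_j k)). (This is the algebraic content of Lemma 5: Q conditionally saturated subtrees with identical topology and hyperparameters but possibly different counts combine, stage by stage, into a single saturated subtree with summed hyperparameters and counts, and the combined stage-wise BDepu product equals the BDepu product of the combined floret obtained by resizing all Q subtrees.) -/
open Real Finset

/-- Lemma 5 (algebraic content): Q conditionally saturated subtrees with identical
topology and hyperparameters but possibly different counts combine, stage by stage,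
into a single saturated subtree with summed hyperparameters and counts, and the
combined stage-wise BDepu product equals the BDepu product of the combined floret
obtained by resizing all Q subtrees. -/
theorem bdepu_resize_cond_saturated (Q r₀ J : ℕ) (hQ : 1 ≤ Q) (hr₀ : 1 ≤ r₀)
    (hJ : J ≤ r₀) (ι : Fin J → Fin r₀) (hι : Function.Injective ι)
    (a : Fin r₀ → ℝ) (ha : ∀ k, 0 < a k)
    (n : Fin Q → Fin r₀ → ℝ) (hn : ∀ q k, 0 ≤ n q k)
    (r : Fin J → ℕ) (hr : ∀ j, 1 ≤ r j)
    (aJ : (j : Fin J) → Fin (r j) → ℝ) (haJ : ∀ j k, 0 < aJ j k)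
    (n' : Fin Q → (j : Fin J) → Fin (r j) → ℝ) (hn' : ∀ q j k, 0 ≤ n' q j k)
    (hmassa : ∀ j, ∑ k, aJ j k = a (ι j))
    (hmassn : ∀ q j, ∑ k, n' q j k = n q (ι j)) :
    (Real.Gamma ((Q : ℝ) * ∑ k, a k) /
        Real.Gamma ((Q : ℝ) * (∑ k, a k) + ∑ q, ∑ k, n q k) *
        ∏ k, Real.Gamma ((Q : ℝ) * a k + ∑ q, n q k) /
          Real.Gamma ((Q : ℝ) * a k)) *
      ∏ j, (Real.Gamma ((Q : ℝ) * a (ι j)) /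
          Real.Gamma ((Q : ℝ) * a (ι j) + ∑ q, n q (ι j)) *
        ∏ k, Real.Gamma ((Q : ℝ) * aJ j k + ∑ q, n' q j k) /
          Real.Gamma ((Q : ℝ) * aJ j k)) =
    Real.Gamma ((Q : ℝ) * ∑ k, a k) /
        Real.Gamma ((Q : ℝ) * (∑ k, a k) + ∑ q, ∑ k, n q k) *
      (∏ k ∈ (Finset.image ι Finset.univ)ᶜ,
        Real.Gamma ((Q : ℝ) * a k + ∑ q, n q k) / Real.Gamma ((Q : ℝ) * a k)) *
      ∏ j, ∏ k, Real.Gamma ((Q : ℝ) * aJ j k + ∑ q, n' q j k) /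
        Real.Gamma ((Q : ℝ) * aJ j k) := by
  have hQ' : (0 : ℝ) < Q := by exact_mod_cast hQ
  have hcancel : (∏ j, Real.Gamma ((Q : ℝ) * a (ι j) + ∑ q, n q (ι j)) /
        Real.Gamma ((Q : ℝ) * a (ι j))) *
      ∏ j, Real.Gamma ((Q : ℝ) * a (ι j)) /
        Real.Gamma ((Q : ℝ) * a (ι j) + ∑ q, n q (ι j)) = 1 := by
    rw [← Finset.prod_mul_distrib]
    refine Finset.prod_eq_one fun j _ => ?_
    have hpos : 0 < (Q : ℝ) * a (ι j) := mul_pos hQ' (ha _)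
    have hsum : 0 ≤ ∑ q, n q (ι j) := Finset.sum_nonneg fun q _ => hn q _
    have h₁ := (Real.Gamma_pos_of_pos hpos).ne'
    have h₂ := (Real.Gamma_pos_of_pos (add_pos_of_pos_of_nonneg hpos hsum)).ne'
    field_simp
  rw [Finset.prod_mul_distrib, ← Finset.prod_mul_prod_compl (Finset.image ι Finset.univ)
    (fun k => Real.Gamma ((Q : ℝ) * a k + ∑ q, n q k) / Real.Gamma ((Q : ℝ) * a k)),
    Finset.prod_image hι.injOn]
  linear_combination (Real.Gamma ((Q : ℝ) * ∑ k, a k) /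
        Real.Gamma ((Q : ℝ) * (∑ k, a k) + ∑ q, ∑ k, n q k) *
      (∏ k ∈ (Finset.image ι Finset.univ)ᶜ,
        Real.Gamma ((Q : ℝ) * a k + ∑ q, n q k) / Real.Gamma ((Q : ℝ) * a k)) *
      ∏ j, ∏ k, Real.Gamma ((Q : ℝ) * aJ j k + ∑ q, n' q j k) /
        Real.Gamma ((Q : ℝ) * aJ j k)) * hcancel
end
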